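/- Let 0 < α < 1, x > 0, and let y be six times continuously differentiable on [0,x]. For an integer n ≥ 4, define the modified L1 weights δ₀ = 1 − ζ(α−1), δ₁ = 2^{1−α} − 2 + 2ζ(α−1), δ₂ = 1 − 2^{2−α} + 3^{1−α} − ζ(α−1), δ_k = (k−1)^{1−α} − 2k^{1−α} + (k+1)^{1−α} for 3 ≤ k ≤ n−1, and δ_n = (n−1)^{1−α} − n^{1−α}. Then there exists a constant C > 0 such that for every integer n ≥ 4, with h = x/n, |(1/(Γ(2−α) h^{α})) ∑_{k=0}^{n} δ_k y((n−k)h) − D^α y(x)| ≤ C h². -/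

import Mathlib

/-- The Riemann zeta function (analytically continued), viewed as a real-valued
function of a real argument. -/
noncomputable def zetaR (s : ℝ) : ℝ := (riemannZeta (s : ℂ)).re

/-- The Caputo fractional derivative of order `α ∈ (0,1)` of `y` at `x`:
`D^α y(x) = (1/Γ(1-α)) ∫₀ˣ y′(t) (x-t)^{-α} dt`. -/
noncomputable def caputo (α : ℝ) (y : ℝ → ℝ) (x : ℝ) : ℝ :=
  (1 / Real.Gamma (1 - α)) * ∫ t in (0:ℝ)..x, deriv y t * (x - t) ^ (-α)

/-- The modified L1 weights `δ_k` (for `n ≥ 4`):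
`δ₀ = 1 - ζ(α-1)`, `δ₁ = 2^{1-α} - 2 + 2ζ(α-1)`,
`δ₂ = 1 - 2^{2-α} + 3^{1-α} - ζ(α-1)`,
`δ_k = (k-1)^{1-α} - 2k^{1-α} + (k+1)^{1-α}` for `3 ≤ k ≤ n-1`, and
`δ_n = (n-1)^{1-α} - n^{1-α}`. -/
noncomputable def ML1weight (α : ℝ) (n k : ℕ) : ℝ :=
  if k = 0 then 1 - zetaR (α - 1)
  else if k = 1 then (2 : ℝ) ^ (1 - α) - 2 + 2 * zetaR (α - 1)
  else if k = 2 then 1 - (2 : ℝ) ^ (2 - α) + (3 : ℝ) ^ (1 - α) - zetaR (α - 1)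
  else if k = n then ((n : ℝ) - 1) ^ (1 - α) - (n : ℝ) ^ (1 - α)
  else ((k : ℝ) - 1) ^ (1 - α) - 2 * (k : ℝ) ^ (1 - α) + ((k : ℝ) + 1) ^ (1 - α)


namespace ML1proof

open Filter Topology Set

lemma hcpow (r : ℂ) {t : ℝ} (ht : 0 < t) :
    HasDerivAt (fun y : ℝ => (y : ℂ) ^ r) (r * (t : ℂ) ^ (r - 1)) t := by
  have h := (hasDerivAt_id (t : ℂ)).cpow_const (c := r) (Or.inl (by simpa using ht))
  simpa using h.comp_ofReal

/-- `(s-1)` times the trapezoidal error of `t ^ (-s)` on `[k+1,k+2]`. -/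
noncomputable def Gterm (k : ℕ) (s : ℂ) : ℂ :=
  (1 / 2) * (s - 1) * (((k + 1 : ℕ) : ℂ) ^ (-s) + ((k + 2 : ℕ) : ℂ) ^ (-s))
    + (((k + 2 : ℕ) : ℂ) ^ (1 - s) - ((k + 1 : ℕ) : ℂ) ^ (1 - s))

lemma Gterm_differentiable (k : ℕ) : Differentiable ℂ (Gterm k) := by
  unfold Gterm
  have h1 : ((k + 1 : ℕ) : ℂ) ≠ 0 := by exact_mod_cast Nat.succ_ne_zero k
  have h2 : ((k + 2 : ℕ) : ℂ) ≠ 0 := by exact_mod_cast Nat.succ_ne_zero (k + 1)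
  intro s
  have e1 : DifferentiableAt ℂ (fun s : ℂ => -s) s := by fun_prop
  have e2 : DifferentiableAt ℂ (fun s : ℂ => 1 - s) s := by fun_prop
  have a1 := e1.const_cpow (c := ((k + 1 : ℕ) : ℂ)) (Or.inl h1)
  have a2 := e1.const_cpow (c := ((k + 2 : ℕ) : ℂ)) (Or.inl h2)
  have a3 := e2.const_cpow (c := ((k + 1 : ℕ) : ℂ)) (Or.inl h1)
  have a4 := e2.const_cpow (c := ((k + 2 : ℕ) : ℂ)) (Or.inl h2)
  have e0 : DifferentiableAt ℂ (fun s : ℂ => (1 / 2) * (s - 1)) s := by fun_prop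
  exact (e0.mul (a1.add a2)).add (a4.sub a3)

lemma Gterm_bound (k : ℕ) (s : ℂ) (hs : -2 ≤ s.re) :
    ‖Gterm k s‖ ≤ ‖s - 1‖ * (‖s‖ * ‖s + 1‖) * ((k + 1 : ℕ) : ℝ) ^ (-s.re - 2) := by
  set a : ℝ := ((k + 1 : ℕ) : ℝ) with ha
  have ha0 : 0 < a := by rw [ha]; positivity
  have hpos : ∀ t ∈ Icc a (a + 1), 0 < t := fun t ht => lt_of_lt_of_le ha0 ht.1
  set B : ℝ := a ^ (-s.re - 2) with hB
  have hB0 : 0 ≤ B := by positivity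
  have hψd : ∀ t ∈ Icc a (a + 1), HasDerivAt
      (fun t : ℝ => (a : ℂ) ^ (-s) - (t : ℂ) ^ (-s) - s * ((t : ℂ) - a) * (t : ℂ) ^ (-s - 1))
      (s * (s + 1) * ((t : ℂ) - a) * (t : ℂ) ^ (-s - 2)) t := by
    intro t ht
    have h0 := hpos t ht
    have h1 := hcpow (-s) h0
    have h2 := hcpow (-s - 1) h0
    have h3 : HasDerivAt (fun t : ℝ => s * ((t : ℂ) - a)) s t := by
      have := ((hasDerivAt_id (t : ℂ)).comp_ofReal.sub_const (a : ℂ)).const_mul s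
      simpa using this
    have := (h1.const_sub ((a : ℂ) ^ (-s))).sub (h3.mul h2)
    convert! this using 1
    rw [show -s - 1 - 1 = -s - 2 by ring]
    ring
  have hnorm : ∀ t ∈ Icc a (a + 1), ‖(t : ℂ) - a‖ ≤ 1 := by
    intro t ht
    rw [← Complex.ofReal_sub, Complex.norm_real, Real.norm_eq_abs, abs_le]
    constructor <;> linarith [ht.1, ht.2]
  have hψ : ∀ t ∈ Icc a (a + 1),
      ‖(a : ℂ) ^ (-s) - (t : ℂ) ^ (-s) - s * ((t : ℂ) - a) * (t : ℂ) ^ (-s - 1)‖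
        ≤ ‖s‖ * ‖s + 1‖ * B := by
    intro t ht
    have := norm_image_sub_le_of_norm_deriv_le_segment' (C := ‖s‖ * ‖s + 1‖ * B)
      (fun x hx => (hψd x hx).hasDerivWithinAt) (by
        intro x hx
        have hx' := Ico_subset_Icc_self hx
        rw [norm_mul, norm_mul, norm_mul]
        have e1 : ‖(x : ℂ) ^ (-s - 2)‖ ≤ B := by
          rw [Complex.norm_cpow_eq_rpow_re_of_pos (hpos x hx')]
          simp only [Complex.sub_re, Complex.neg_re, Complex.re_ofNat]
          exact Real.rpow_le_rpow_of_nonpos ha0 hx'.1 (by linarith)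
        calc ‖s‖ * ‖s + 1‖ * ‖(x : ℂ) - a‖ * ‖(x : ℂ) ^ (-s - 2)‖
            ≤ ‖s‖ * ‖s + 1‖ * 1 * B := by
              gcongr
              exact hnorm x hx'
          _ = _ := by ring) t ht
    simp only [sub_self, mul_zero, zero_mul, sub_zero] at this
    refine this.trans ?_
    have : t - a ≤ 1 := by linarith [ht.2]
    have h0 : 0 ≤ ‖s‖ * ‖s + 1‖ * B := by positivity
    nlinarith
  have hφd : ∀ t ∈ Icc a (a + 1), HasDerivAt
      (fun t : ℝ => (1 / 2) * (s - 1) * ((t : ℂ) - a) * ((a : ℂ) ^ (-s) + (t : ℂ) ^ (-s))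
        + ((t : ℂ) ^ (1 - s) - (a : ℂ) ^ (1 - s)))
      ((1 / 2) * (s - 1) *
        ((a : ℂ) ^ (-s) - (t : ℂ) ^ (-s) - s * ((t : ℂ) - a) * (t : ℂ) ^ (-s - 1))) t := by
    intro t ht
    have h0 := hpos t ht
    have h1 := hcpow (-s) h0
    have h2 := hcpow (1 - s) h0
    have h3 : HasDerivAt (fun t : ℝ => (1 / 2) * (s - 1) * ((t : ℂ) - a))
        ((1 / 2) * (s - 1)) t := by
      have := ((hasDerivAt_id (t : ℂ)).comp_ofReal.sub_const (a : ℂ)).const_mul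
        ((1 / 2) * (s - 1))
      simpa using this
    have := (h3.mul (h1.const_add ((a : ℂ) ^ (-s)))).add (h2.sub_const ((a : ℂ) ^ (1 - s)))
    convert! this using 1
    rw [show 1 - s - 1 = -s by ring]
    ring
  have hfin := norm_image_sub_le_of_norm_deriv_le_segment'
      (C := ‖s - 1‖ * (‖s‖ * ‖s + 1‖ * B))
      (fun x hx => (hφd x hx).hasDerivWithinAt) (by
        intro x hx
        have hx' := Ico_subset_Icc_self hx
        rw [norm_mul, norm_mul]
        have e2 : ‖(1 / 2 : ℂ)‖ ≤ 1 := by norm_num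
        calc _ ≤ 1 * ‖s - 1‖ * (‖s‖ * ‖s + 1‖ * B) := by
              gcongr
              exact hψ x hx'
          _ = _ := by ring) (a + 1) ⟨by linarith, le_rfl⟩
  have hG : Gterm k s = (1 / 2) * (s - 1) * (((a + 1 : ℝ) : ℂ) - a) *
        ((a : ℂ) ^ (-s) + ((a + 1 : ℝ) : ℂ) ^ (-s))
        + (((a + 1 : ℝ) : ℂ) ^ (1 - s) - (a : ℂ) ^ (1 - s)) := by
    have e1 : ((k + 1 : ℕ) : ℂ) = (a : ℂ) := by rw [ha]; push_cast; rfl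
    have e2 : ((k + 2 : ℕ) : ℂ) = ((a + 1 : ℝ) : ℂ) := by rw [ha]; push_cast; ring
    unfold Gterm
    rw [e1, e2]
    push_cast
    ring
  rw [hG]
  simp only [sub_self, mul_zero, zero_mul, sub_zero, add_zero] at hfin
  refine hfin.trans (le_of_eq ?_)
  ring

lemma Gterm_sum (N : ℕ) (s : ℂ) :
    ∑ k ∈ Finset.range N, Gterm k s =
      (s - 1) * (∑ k ∈ Finset.range N, ((k + 1 : ℕ) : ℂ) ^ (-s)
        + (1 / 2) * ((N + 1 : ℕ) : ℂ) ^ (-s) - 1 / 2) + ((N + 1 : ℕ) : ℂ) ^ (1 - s) - 1 := by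
  induction N with
  | zero => simp
  | succ n ih =>
    rw [Finset.sum_range_succ, ih, Finset.sum_range_succ]
    unfold Gterm
    ring

lemma Gterm_summable_aux (γ : ℝ) (hγ : γ < 1) :
    Summable (fun k : ℕ => 1000 * ((k + 1 : ℕ) : ℝ) ^ (γ - 2)) := by
  apply Summable.mul_left
  exact (summable_nat_add_iff (f := fun k : ℕ => (k : ℝ) ^ (γ - 2)) 1).2
    (Real.summable_nat_rpow.2 (by linarith))

lemma Gterm_bound' (γ : ℝ) (hγ : γ < 1) (k : ℕ) (s : ℂ)
    (hs : s ∈ {s : ℂ | -γ < s.re} ∩ Metric.ball 0 4) :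
    ‖Gterm k s‖ ≤ 1000 * ((k + 1 : ℕ) : ℝ) ^ (γ - 2) := by
  obtain ⟨h1, h2⟩ := hs
  simp only [mem_ofPred_eq, Metric.mem_ball, dist_zero_right] at h1 h2
  refine (Gterm_bound k s (by linarith)).trans ?_
  have e1 : ‖s - 1‖ ≤ 5 := (norm_sub_le _ _).trans (by simp; linarith)
  have e2 : ‖s + 1‖ ≤ 5 := (norm_add_le _ _).trans (by simp; linarith)
  have e3 : ((k + 1 : ℕ) : ℝ) ^ (-s.re - 2) ≤ ((k + 1 : ℕ) : ℝ) ^ (γ - 2) := by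
    apply Real.rpow_le_rpow_of_exponent_le
    · push_cast; linarith [Nat.cast_nonneg (α := ℝ) k]
    · linarith
  calc _ ≤ 5 * (4 * 5) * ((k + 1 : ℕ) : ℝ) ^ (γ - 2) := by gcongr
    _ ≤ _ := by
      have : 0 ≤ ((k + 1 : ℕ) : ℝ) ^ (γ - 2) := by positivity
      linarith

lemma Gterm_tsum_large (s : ℂ) (hs : 1 < s.re) (hsum : Summable (fun k => Gterm k s)) :
    riemannZeta₁ s = (s - 1) / 2 + 1 + ∑' k, Gterm k s := by
  have hs1 : s ≠ 1 := by rintro rfl; simp at hs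
  have hz : riemannZeta₁ s = (s - 1) * riemannZeta s := by
    rw [riemannZeta_eq_inv_sub_mul hs1]
    field_simp [sub_ne_zero.2 hs1]
  have h1 := hsum.hasSum.tendsto_sum_nat
  have hzs : HasSum (fun k : ℕ => ((k + 1 : ℕ) : ℂ) ^ (-s)) (riemannZeta s) := by
    have hh : Summable (fun k : ℕ => ((k + 1 : ℕ) : ℂ) ^ (-s)) := by
      have := (summable_nat_add_iff 1).2 (Complex.summable_one_div_nat_cpow.2 hs)
      refine this.congr fun k => ?_
      rw [Complex.cpow_neg, one_div]
    convert! hh.hasSum using 1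
    rw [zeta_eq_tsum_one_div_nat_add_one_cpow hs]
    refine tsum_congr fun k => ?_
    rw [Complex.cpow_neg, one_div]
    push_cast; rfl
  have hlim : ∀ r : ℂ, r.re < 0 →
      Tendsto (fun N : ℕ => ((N + 1 : ℕ) : ℂ) ^ r) atTop (𝓝 0) := by
    intro r hr
    rw [tendsto_zero_iff_norm_tendsto_zero]
    have : Tendsto (fun N : ℕ => ((N + 1 : ℕ) : ℝ) ^ r.re) atTop (𝓝 0) := by
      have h := tendsto_rpow_neg_atTop (y := -r.re) (by linarith)
      rw [neg_neg] at h
      exact h.comp (tendsto_natCast_atTop_atTop.comp (tendsto_add_atTop_nat 1))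
    refine this.congr fun N => ?_
    rw [← Complex.norm_cpow_eq_rpow_re_of_pos (by positivity)]
    simp
  have h2 : Tendsto (fun N => ∑ k ∈ Finset.range N, Gterm k s) atTop
      (𝓝 ((s - 1) * (riemannZeta s + (1 / 2) * 0 - 1 / 2) + 0 - 1)) := by
    simp_rw [Gterm_sum]
    refine (((((hzs.tendsto_sum_nat).add ((hlim (-s) ?_).const_mul _)).sub_const _).const_mul
      _).add (hlim (1 - s) ?_)).sub_const _
    · simp; linarith
    · simp; linarith
  have := tendsto_nhds_unique h1 h2
  rw [this, hz]
  ring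

lemma zeta_lim_C (β : ℝ) (h0 : 0 < β) (h1 : β < 1) :
    HasSum (fun k => Gterm k (-β : ℂ)) (riemannZeta₁ (-β) - (((-β : ℂ) - 1) / 2 + 1)) := by
  obtain ⟨γ, hγ0, hγ1⟩ := exists_between h1
  set U : Set ℂ := {s : ℂ | -γ < s.re} ∩ Metric.ball 0 4 with hU
  have hUo : IsOpen U := (isOpen_lt continuous_const Complex.continuous_re).inter Metric.isOpen_ball
  have hUc : Convex ℝ U := by
    refine Convex.inter ?_ (convex_ball _ _)
    exact convex_halfSpace_re_gt _
  have hbd := fun k w hw => Gterm_bound' γ hγ1 k w hw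
  have hs := Gterm_summable_aux γ hγ1
  have hd : DifferentiableOn ℂ (fun w => ∑' k, Gterm k w) U :=
    Complex.differentiableOn_tsum_of_summable_norm hs
      (fun k => (Gterm_differentiable k).differentiableOn) hUo hbd
  have hsumm : ∀ w ∈ U, Summable (fun k => Gterm k w) := fun w hw =>
    Summable.of_norm_bounded hs (fun k => hbd k w hw)
  have hd2 : DifferentiableOn ℂ (fun w => (w - 1) / 2 + 1 + ∑' k, Gterm k w) U := by
    refine DifferentiableOn.add ?_ hd
    fun_prop
  have h2U : (2 : ℂ) ∈ U := by
    constructor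
    · simp; linarith
    · simp; norm_num
  have hβU : (-β : ℂ) ∈ U := by
    constructor
    · simp; linarith
    · simp [abs_of_pos h0]; linarith
  have heq := (differentiable_riemannZeta₁.differentiableOn.analyticOnNhd hUo
    ).eqOn_of_preconnected_of_eventuallyEq
    (hd2.analyticOnNhd hUo) hUc.isPreconnected h2U (by
      have hn : {s : ℂ | 1 < s.re} ∈ 𝓝 (2 : ℂ) :=
        (isOpen_lt continuous_const Complex.continuous_re).mem_nhds (by simp)
      filter_upwards [hn, hUo.mem_nhds h2U] with s hs hsU
      exact Gterm_tsum_large s hs (hsumm s hsU)) hβU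
  have := (hsumm _ hβU).hasSum
  convert! this using 1
  rw [heq]
  simp

/-- Euler-Maclaurin partial expression. -/
noncomputable def Tn (β : ℝ) (N : ℕ) : ℝ :=
  ∑ k ∈ Finset.range N, ((k + 1 : ℕ) : ℝ) ^ β + (1 / 2) * ((N + 1 : ℕ) : ℝ) ^ β
    - ((N + 1 : ℕ) : ℝ) ^ (1 + β) / (1 + β)

lemma zeta_lim (β : ℝ) (h0 : 0 < β) (h1 : β < 1) :
    Tendsto (Tn β) atTop (𝓝 (zetaR (-β))) := by
  have h := (zeta_lim_C β h0 h1).tendsto_sum_nat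
  have hb : (1 + β : ℂ) ≠ 0 := by
    have : (1 + β : ℝ) ≠ 0 := by linarith
    exact_mod_cast this
  have hb' : (-β - 1 : ℂ) ≠ 0 := by
    intro h; apply hb; linear_combination -h
  have hne : (-β : ℂ) ≠ 1 := by
    intro h; apply hb; linear_combination -h
  have key : ∀ N, ((Tn β N : ℝ) : ℂ) = (∑ k ∈ Finset.range N, Gterm k (-β : ℂ)) / (-β - 1)
      + 1 / 2 + 1 / (-β - 1) := by
    intro N
    rw [Gterm_sum]
    unfold Tn
    simp only [Complex.ofReal_sub, Complex.ofReal_add, Complex.ofReal_mul, Complex.ofReal_div,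
      Complex.ofReal_sum]
    simp_rw [Complex.ofReal_cpow (Nat.cast_nonneg _)]
    simp only [neg_neg, sub_neg_eq_add, Complex.ofReal_natCast, Complex.ofReal_add,
      Complex.ofReal_one, Complex.ofReal_ofNat]
    rw [show (-β - 1 : ℂ) = -(1 + β) by ring]
    field_simp
    ring
  have h2 : Tendsto (fun N => ((Tn β N : ℝ) : ℂ)) atTop (𝓝 (riemannZeta (-β))) := by
    simp_rw [key]
    have := ((h.div_const (-β - 1 : ℂ)).add_const (1 / 2)).add_const (1 / (-β - 1 : ℂ))
    convert! this using 2
    rw [riemannZeta_eq_inv_sub_mul hne]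
    field_simp
    ring
  have h3 := (Complex.continuous_re.tendsto _).comp h2
  simpa [Function.comp_def, zetaR] using! h3

lemma Tn_step (β : ℝ) (h0 : 0 < β) (h1 : β < 1) (N : ℕ) :
    |Tn β (N + 1) - Tn β N| ≤ ((N + 1 : ℕ) : ℝ) ^ (β - 2) := by
  have hb : (1 + β : ℂ) ≠ 0 := by
    have : (1 + β : ℝ) ≠ 0 := by linarith
    exact_mod_cast this
  have hG : Gterm N (-β : ℂ) = ((-(1 + β) * (Tn β (N + 1) - Tn β N) : ℝ) : ℂ) := by
    unfold Tn Gterm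
    rw [Finset.sum_range_succ]
    simp only [Complex.ofReal_sub, Complex.ofReal_add, Complex.ofReal_mul, Complex.ofReal_div,
      Complex.ofReal_sum, Complex.ofReal_neg]
    simp_rw [Complex.ofReal_cpow (Nat.cast_nonneg _)]
    simp only [neg_neg, sub_neg_eq_add, Complex.ofReal_natCast, Complex.ofReal_add,
      Complex.ofReal_one, Complex.ofReal_ofNat]
    field_simp
    ring
  have hB := Gterm_bound N (-β : ℂ) (by simp; linarith)
  rw [hG, Complex.norm_real, Real.norm_eq_abs, abs_mul, abs_neg, abs_of_pos (by linarith : 0 < 1 + β)]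
    at hB
  have e1 : ‖(-β : ℂ) - 1‖ = 1 + β := by
    rw [show (-β : ℂ) - 1 = ((-(1 + β) : ℝ) : ℂ) by push_cast; ring, Complex.norm_real,
      Real.norm_eq_abs, abs_neg, abs_of_pos (by linarith)]
  have e2 : ‖(-β : ℂ) + 1‖ = 1 - β := by
    rw [show (-β : ℂ) + 1 = ((1 - β : ℝ) : ℂ) by push_cast; ring, Complex.norm_real,
      Real.norm_eq_abs, abs_of_pos (by linarith)]
  have e3 : ‖(-β : ℂ)‖ = β := by simp [abs_of_pos h0]
  rw [e1, e2, e3, mul_assoc] at hB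
  have hB' := le_of_mul_le_mul_left hB (by linarith)
  simp only [Complex.neg_re, Complex.ofReal_re, neg_neg] at hB'
  refine hB'.trans ?_
  have : 0 ≤ ((N + 1 : ℕ) : ℝ) ^ (β - 2) := by positivity
  nlinarith [mul_nonneg h0.le this, mul_nonneg (mul_nonneg h0.le h0.le) this]

lemma rpow_tele (α a : ℝ) (h0 : 0 < α) (h1 : α < 1) (ha : 1 ≤ a) :
    a ^ (-α - 1) ≤ (2 ^ (1 + α) / α) * (a ^ (-α) - (a + 1) ^ (-α)) := by
  have hd : ∀ t, 0 < t → HasDerivAt (fun t : ℝ => t ^ (-α)) (-α * t ^ (-α - 1)) t := fun t ht =>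
    Real.hasDerivAt_rpow_const (Or.inl ht.ne')
  obtain ⟨ξ, hξ, he⟩ := exists_hasDerivAt_eq_slope (fun t : ℝ => t ^ (-α))
    (fun t => -α * t ^ (-α - 1)) (by linarith : a < a + 1)
    (fun t ht => (hd t (by linarith [ht.1])).continuousAt.continuousWithinAt)
    (fun t ht => hd t (by linarith [ht.1]))
  have hle : (2 * a) ^ (-α - 1) ≤ ξ ^ (-α - 1) :=
    Real.rpow_le_rpow_of_nonpos (by linarith [hξ.1]) (by linarith [hξ.2]) (by linarith)
  rw [Real.mul_rpow (by norm_num) (by linarith)] at hle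
  have h2 : (2 : ℝ) ^ (-α - 1) = ((2 : ℝ) ^ (1 + α))⁻¹ := by
    rw [← Real.rpow_neg (by norm_num)]; congr 1; ring
  rw [h2] at hle
  have hp : (0 : ℝ) < 2 ^ (1 + α) := by positivity
  have he' : a ^ (-α) - (a + 1) ^ (-α) = α * ξ ^ (-α - 1) := by
    rw [add_sub_cancel_left, div_one] at he
    linarith
  rw [he']
  rw [inv_mul_le_iff₀ hp] at hle
  calc _ ≤ _ := hle
    _ = _ := by field_simp

lemma Tn_rate (β : ℝ) (h0 : 0 < β) (h1 : β < 1) :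
    ∃ K, 0 ≤ K ∧ ∀ N : ℕ, |Tn β N - zetaR (-β)| ≤ K * ((N + 1 : ℕ) : ℝ) ^ (-(1 - β)) := by
  set K : ℝ := 2 ^ (1 + (1 - β)) / (1 - β) with hK
  have hK0 : 0 ≤ K := by
    have : 0 < 1 - β := by linarith
    positivity
  refine ⟨K, hK0, fun N => ?_⟩
  have hstep : ∀ j : ℕ, |Tn β (N + j) - Tn β N| ≤
      K * (((N + 1 : ℕ) : ℝ) ^ (-(1 - β)) - ((N + j + 1 : ℕ) : ℝ) ^ (-(1 - β))) := by
    intro j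
    induction j with
    | zero => simp
    | succ j ih =>
      have e1 := Tn_step β h0 h1 (N + j)
      have e2 := rpow_tele (1 - β) ((N + j + 1 : ℕ) : ℝ) (by linarith) (by linarith)
        (by exact_mod_cast Nat.le_add_left 1 (N + j))
      rw [← hK, show -(1 - β) - 1 = β - 2 by ring] at e2
      have e3 : (((N + j + 1 : ℕ) : ℝ) + 1) = ((N + (j + 1) + 1 : ℕ) : ℝ) := by push_cast; ring
      rw [e3] at e2
      have e4 := abs_sub_le (Tn β (N + (j + 1))) (Tn β (N + j)) (Tn β N)
      have e5 : N + (j + 1) = N + j + 1 := rfl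
      rw [e5] at e4 e2 ⊢
      linarith
  have hlim : Tendsto (fun j => |Tn β (N + j) - Tn β N|) atTop (𝓝 |zetaR (-β) - Tn β N|) := by
    have : Tendsto (fun j => Tn β (N + j)) atTop (𝓝 (zetaR (-β))) := by
      have := (tendsto_add_atTop_iff_nat N).2 (zeta_lim β h0 h1)
      simpa only [add_comm] using this
    exact (this.sub_const _).abs
  rw [abs_sub_comm]
  refine le_of_tendsto' hlim fun j => (hstep j).trans ?_
  gcongr
  have : 0 ≤ ((N + j + 1 : ℕ) : ℝ) ^ (-(1 - β)) := by positivity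
  linarith

lemma cell_aux (α a b B : ℝ) (h0 : 0 < α) (h1 : α < 1) (ha : 0 ≤ a) (hab : a < b) (ρ : ℝ → ℝ)
    (hc : ContinuousOn ρ (Icc a b)) (hB : ∀ s ∈ Icc a b, |ρ s| ≤ B)
    (hz : ∫ s in a..b, ρ s = 0) :
    |∫ s in a..b, ρ s * s ^ (-α)| ≤ B * ((∫ s in a..b, s ^ (-α)) - (b - a) * b ^ (-α)) := by
  have hi : IntervalIntegrable (fun s : ℝ => s ^ (-α)) MeasureTheory.volume a b :=
    intervalIntegral.intervalIntegrable_rpow' (by linarith)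
  have hcu : ContinuousOn ρ (uIcc a b) := by rwa [uIcc_of_le hab.le]
  have hρi : IntervalIntegrable ρ MeasureTheory.volume a b := hcu.intervalIntegrable
  have hi2 : IntervalIntegrable (fun s : ℝ => ρ s * s ^ (-α)) MeasureTheory.volume a b :=
    hi.continuousOn_mul hcu
  have e1 : ∫ s in a..b, ρ s * s ^ (-α) = ∫ s in a..b, ρ s * (s ^ (-α) - b ^ (-α)) := by
    simp_rw [mul_sub]
    rw [intervalIntegral.integral_sub hi2 (hρi.mul_const _), intervalIntegral.integral_mul_const,
      hz]
    ring
  have e2 : B * ((∫ s in a..b, s ^ (-α)) - (b - a) * b ^ (-α)) =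
      ∫ s in a..b, B * (s ^ (-α) - b ^ (-α)) := by
    rw [intervalIntegral.integral_const_mul, intervalIntegral.integral_sub hi (by simp),
      intervalIntegral.integral_const, smul_eq_mul]
  rw [e1, e2, ← Real.norm_eq_abs]
  refine intervalIntegral.norm_integral_le_of_norm_le hab.le ?_ ?_
  · refine Eventually.of_forall fun s hs => ?_
    have hs0 : 0 < s := lt_of_le_of_lt ha hs.1
    have : b ^ (-α) ≤ s ^ (-α) := Real.rpow_le_rpow_of_nonpos hs0 hs.2 (by linarith)
    rw [norm_mul, Real.norm_eq_abs, Real.norm_eq_abs, abs_of_nonneg (by linarith : 0 ≤ s ^ (-α) - b ^ (-α))]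
    exact mul_le_mul_of_nonneg_right (hB s ⟨hs.1.le, hs.2⟩) (by linarith)
  · exact (hi.sub (by simp)).const_mul _

lemma cell (α x a b c M : ℝ) (h0 : 0 < α) (h1 : α < 1) (ha : 0 ≤ a) (hab : a < b) (hbx : b ≤ x)
    (hM : 0 ≤ M) (u u1 u2 : ℝ → ℝ)
    (hu : ∀ s ∈ Icc 0 x, HasDerivWithinAt u (u1 s) (Icc 0 x) s)
    (hu1 : ∀ s ∈ Icc 0 x, HasDerivWithinAt u1 (u2 s) (Icc 0 x) s)
    (hu2 : ∀ s ∈ Icc 0 x, |u2 s - c| ≤ M * s) :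
    |(∫ s in a..b, u1 s * s ^ (-α)) - (u b - u a) / (b - a) * (∫ s in a..b, s ^ (-α))
      - c * ((∫ s in a..b, s ^ (1 - α)) - (a + b) / 2 * (∫ s in a..b, s ^ (-α)))|
      ≤ M * b * (b - a) * ((∫ s in a..b, s ^ (-α)) - (b - a) * b ^ (-α)) := by
  have hsub : Icc a b ⊆ Icc 0 x := Icc_subset_Icc ha hbx
  set d := (u b - u a) / (b - a) with hd
  have hba : b - a ≠ 0 := by linarith
  set ρ : ℝ → ℝ := fun s => u1 s - d - c * (s - (a + b) / 2) with hρ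
  set w : ℝ → ℝ := fun s => u s - d * s - c * (s ^ 2 / 2 - (a + b) / 2 * s) with hw
  have hwd : ∀ s ∈ Icc a b, HasDerivWithinAt w (ρ s) (Icc a b) s := by
    intro s hs
    have e1 := (hu s (hsub hs)).mono hsub
    have e2 : HasDerivAt (fun s : ℝ => d * s + c * (s ^ 2 / 2 - (a + b) / 2 * s))
        (d + c * (s - (a + b) / 2)) s := by
      have i1 := (hasDerivAt_id s).const_mul d
      have i2 := ((((hasDerivAt_id s).pow 2).div_const 2).sub
        ((hasDerivAt_id s).const_mul ((a + b) / 2))).const_mul c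
      convert! i1.add i2 using 1
      simp
    convert! e1.sub e2.hasDerivWithinAt using 1
    · funext t; simp [hw]; ring
    · simp [hρ]; ring
  have hρd : ∀ s ∈ Icc a b, HasDerivWithinAt ρ (u2 s - c) (Icc a b) s := by
    intro s hs
    have e1 := (hu1 s (hsub hs)).mono hsub
    have e2 : HasDerivAt (fun s : ℝ => d + c * (s - (a + b) / 2)) c s := by
      have i2 := (((hasDerivAt_id s).sub_const ((a + b) / 2)).const_mul c).const_add d
      convert! i2 using 1
      simp
    convert! e1.sub e2.hasDerivWithinAt using 1
    funext t; simp [hρ]; ring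
  have hρc : ContinuousOn ρ (Icc a b) := fun s hs => (hρd s hs).continuousWithinAt
  have hwc : ContinuousOn w (Icc a b) := fun s hs => (hwd s hs).continuousWithinAt
  have hwab : w a = w b := by
    simp only [hw, hd]
    field_simp
    ring
  have hwi : ∀ s ∈ Ioo a b, HasDerivAt w (ρ s) s := fun s hs =>
    (hwd s (Ioo_subset_Icc_self hs)).hasDerivAt (Icc_mem_nhds hs.1 hs.2)
  have hint : ∫ s in a..b, ρ s = 0 := by
    rw [intervalIntegral.integral_eq_sub_of_hasDerivAt_of_le hab.le hwc hwi
      (by apply ContinuousOn.intervalIntegrable; rwa [uIcc_of_le hab.le]), hwab, sub_self]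
  obtain ⟨ξ, hξ, hξ0⟩ := exists_hasDerivAt_eq_zero hab hwc hwab hwi
  have hb0 : 0 < b := lt_of_le_of_lt ha hab
  have hbound : ∀ s ∈ Icc a b, |ρ s| ≤ M * b * (b - a) := by
    intro s hs
    have := (convex_Icc a b).norm_image_sub_le_of_norm_hasDerivWithin_le (C := M * b) hρd
      (by
        intro t ht
        rw [Real.norm_eq_abs]
        exact (hu2 t (hsub ht)).trans (mul_le_mul_of_nonneg_left ht.2 hM))
      (Ioo_subset_Icc_self hξ) hs
    rw [hξ0, sub_zero, Real.norm_eq_abs, Real.norm_eq_abs] at this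
    refine this.trans ?_
    have : |s - ξ| ≤ b - a := by
      rw [abs_le]; constructor <;> linarith [hs.1, hs.2, hξ.1, hξ.2]
    gcongr
  have hmain := cell_aux α a b _ h0 h1 ha hab ρ hρc hbound hint
  have hi : IntervalIntegrable (fun s : ℝ => s ^ (-α)) MeasureTheory.volume a b :=
    intervalIntegral.intervalIntegrable_rpow' (by linarith)
  have hi1 : IntervalIntegrable (fun s : ℝ => s ^ (1 - α)) MeasureTheory.volume a b :=
    intervalIntegral.intervalIntegrable_rpow' (by linarith)
  have hiu : IntervalIntegrable (fun s : ℝ => u1 s * s ^ (-α)) MeasureTheory.volume a b := by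
    refine hi.continuousOn_mul ?_
    rw [uIcc_of_le hab.le]
    exact fun s hs => ((hu1 s (hsub hs)).mono hsub).continuousWithinAt
  have heq : ∫ s in a..b, ρ s * s ^ (-α) = (∫ s in a..b, u1 s * s ^ (-α)) -
      d * (∫ s in a..b, s ^ (-α))
      - c * ((∫ s in a..b, s ^ (1 - α)) - (a + b) / 2 * (∫ s in a..b, s ^ (-α))) := by
    rw [← intervalIntegral.integral_const_mul, ← intervalIntegral.integral_const_mul,
      ← intervalIntegral.integral_sub hi1 (hi.const_mul _), ← intervalIntegral.integral_const_mul,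
      ← intervalIntegral.integral_sub hiu (hi.const_mul _),
      ← intervalIntegral.integral_sub (hiu.sub (hi.const_mul _))
        ((hi1.sub (hi.const_mul _)).const_mul _)]
    refine intervalIntegral.integral_congr fun s hs => ?_
    rw [uIcc_of_le hab.le] at hs
    have hs0 : 0 ≤ s := ha.trans hs.1
    have : s ^ (1 - α) = s * s ^ (-α) := by
      rw [sub_eq_add_neg, Real.rpow_add' hs0 (by linarith), Real.rpow_one]
    simp only [hρ, this]
    ring
  rw [heq] at hmain
  exact hmain

lemma sum_T (β : ℝ) (h0 : 0 < β) (N : ℕ) :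
    ∑ k ∈ Finset.range (N + 1), ((((k + 1 : ℕ) : ℝ) ^ (1 + β) - (k : ℝ) ^ (1 + β)) / (1 + β)
      - ((k : ℝ) + 1 / 2) * ((((k + 1 : ℕ) : ℝ) ^ β - (k : ℝ) ^ β) / β)) = Tn β N / β := by
  have hp : ∀ k : ℕ, (k : ℝ) ^ (1 + β) = k * (k : ℝ) ^ β := fun k => by
    rw [Real.rpow_add' (Nat.cast_nonneg _) (by linarith), Real.rpow_one]
  have hb : 1 + β ≠ 0 := by linarith
  unfold Tn
  simp_rw [hp]
  induction N with
  | zero =>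
    simp [Real.zero_rpow h0.ne']
    field_simp
    ring
  | succ n ih =>
    rw [Finset.sum_range_succ, ih, Finset.sum_range_succ]
    push_cast
    field_simp
    ring

lemma sum_err (β : ℝ) (h0 : 0 < β) (h1 : β < 1) (n : ℕ) :
    ∑ k ∈ Finset.range n, ((k : ℝ) + 1) * ((((k + 1 : ℕ) : ℝ) ^ β - (k : ℝ) ^ β) / β
      - ((k + 1 : ℕ) : ℝ) ^ (β - 1)) ≤ (n : ℝ) ^ β / β := by
  induction n with
  | zero => simp [Real.zero_rpow h0.ne']
  | succ k ih =>
    rw [Finset.sum_range_succ]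
    have hk1 : (0 : ℝ) < ((k + 1 : ℕ) : ℝ) := by positivity
    have e1 : ((k : ℝ) + 1) * ((k + 1 : ℕ) : ℝ) ^ (β - 1) = ((k + 1 : ℕ) : ℝ) ^ β := by
      rw [Real.rpow_sub_one hk1.ne']
      push_cast
      field_simp
    have e2 : (k : ℝ) * (((k + 1 : ℕ) : ℝ) ^ β - (k : ℝ) ^ β) ≤ β * ((k + 1 : ℕ) : ℝ) ^ β := by
      rcases Nat.eq_zero_or_pos k with rfl | hk
      · simp [Real.zero_rpow h0.ne', h0.le]
      · have hk0 : (0 : ℝ) < k := by exact_mod_cast hk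
        have b1 := rpow_one_add_le_one_add_mul_self (s := 1 / (k : ℝ)) (p := β)
          (by have : 0 < 1 / (k : ℝ) := by positivity
              linarith) h0.le h1.le
        have b2 : ((k + 1 : ℕ) : ℝ) ^ β = (k : ℝ) ^ β * (1 + 1 / (k : ℝ)) ^ β := by
          rw [← Real.mul_rpow hk0.le (by positivity)]
          congr 1
          push_cast
          field_simp
        have b3 : (k : ℝ) ^ β ≤ ((k + 1 : ℕ) : ℝ) ^ β :=
          Real.rpow_le_rpow hk0.le (by push_cast; linarith) h0.le
        have b4 : (0 : ℝ) < (k : ℝ) ^ β := by positivity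
        calc (k : ℝ) * (((k + 1 : ℕ) : ℝ) ^ β - (k : ℝ) ^ β)
            ≤ (k : ℝ) * ((k : ℝ) ^ β * (1 + β * (1 / (k : ℝ))) - (k : ℝ) ^ β) := by
              rw [b2]; gcongr
          _ = β * (k : ℝ) ^ β := by field_simp; ring
          _ ≤ _ := by gcongr
    have e3 : ((k : ℝ) + 1) * ((((k + 1 : ℕ) : ℝ) ^ β - (k : ℝ) ^ β) / β
      - ((k + 1 : ℕ) : ℝ) ^ (β - 1)) ≤ (((k + 1 : ℕ) : ℝ) ^ β - (k : ℝ) ^ β) / β := by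
      rw [mul_sub, e1, ← sub_nonneg]
      have : (((k + 1 : ℕ) : ℝ) ^ β - (k : ℝ) ^ β) / β - (((k : ℝ) + 1) *
        ((((k + 1 : ℕ) : ℝ) ^ β - (k : ℝ) ^ β) / β) - ((k + 1 : ℕ) : ℝ) ^ β)
        = (β * ((k + 1 : ℕ) : ℝ) ^ β - (k : ℝ) * (((k + 1 : ℕ) : ℝ) ^ β - (k : ℝ) ^ β)) / β := by
        field_simp; ring
      rw [this]
      exact div_nonneg (by linarith) h0.le
    calc _ ≤ (k : ℝ) ^ β / β + (((k + 1 : ℕ) : ℝ) ^ β - (k : ℝ) ^ β) / β := add_le_add ih e3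
      _ = _ := by ring

/-- L1 error expansion. -/
lemma L1_expansion (α x h c M : ℝ) (h0 : 0 < α) (h1 : α < 1) (hh : 0 < h) (N : ℕ)
    (hx : x = ((N + 1 : ℕ) : ℝ) * h)
    (hM : 0 ≤ M) (u u1 u2 : ℝ → ℝ)
    (hu : ∀ s ∈ Icc 0 x, HasDerivWithinAt u (u1 s) (Icc 0 x) s)
    (hu1 : ∀ s ∈ Icc 0 x, HasDerivWithinAt u1 (u2 s) (Icc 0 x) s)
    (hu2 : ∀ s ∈ Icc 0 x, |u2 s - c| ≤ M * s) :
    |(∫ s in (0:ℝ)..x, u1 s * s ^ (-α))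
      - h ^ (-α) / (1 - α) * ∑ k ∈ Finset.range (N + 1),
          (u (((k + 1 : ℕ) : ℝ) * h) - u ((k : ℝ) * h)) *
            (((k + 1 : ℕ) : ℝ) ^ (1 - α) - (k : ℝ) ^ (1 - α))
      - c * h ^ (2 - α) * (Tn (1 - α) N / (1 - α))|
      ≤ M * h ^ (3 - α) * (((N + 1 : ℕ) : ℝ) ^ (1 - α) / (1 - α)) := by
  set β := 1 - α with hβ
  have hβ0 : 0 < β := by rw [hβ]; linarith
  have hα : -α = β - 1 := by rw [hβ]; ring
  have hu1c : ContinuousOn u1 (Icc 0 x) := fun s hs => (hu1 s hs).continuousWithinAt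
  have ha : ∀ k : ℕ, 0 ≤ (k : ℝ) * h := fun k => by positivity
  have hab : ∀ k : ℕ, (k : ℝ) * h < ((k + 1 : ℕ) : ℝ) * h := fun k => by push_cast; nlinarith
  have hbx : ∀ k < N + 1, ((k + 1 : ℕ) : ℝ) * h ≤ x := fun k hk => by
    rw [hx]
    have : ((k + 1 : ℕ) : ℝ) ≤ ((N + 1 : ℕ) : ℝ) := by exact_mod_cast hk
    gcongr
  have hdiff : ∀ k : ℕ, ((k + 1 : ℕ) : ℝ) * h - (k : ℝ) * h = h := fun k => by push_cast; ring
  have hI0 : ∀ k : ℕ, ∫ s in ((k : ℝ) * h)..(((k + 1 : ℕ) : ℝ) * h), s ^ (-α) =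
      h ^ β * ((((k + 1 : ℕ) : ℝ) ^ β - (k : ℝ) ^ β) / β) := fun k => by
    rw [integral_rpow (Or.inl (by linarith)), hα, sub_add_cancel,
      Real.mul_rpow (by positivity) hh.le, Real.mul_rpow (by positivity) hh.le]
    ring
  have hI1 : ∀ k : ℕ, ∫ s in ((k : ℝ) * h)..(((k + 1 : ℕ) : ℝ) * h), s ^ β =
      h ^ (1 + β) * ((((k + 1 : ℕ) : ℝ) ^ (1 + β) - (k : ℝ) ^ (1 + β)) / (1 + β)) := fun k => by
    rw [integral_rpow (Or.inl (by linarith)), add_comm β 1,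
      Real.mul_rpow (by positivity) hh.le, Real.mul_rpow (by positivity) hh.le]
    ring
  have hp1 : h ^ (1 + β) = h * h ^ β := by rw [Real.rpow_add hh, Real.rpow_one]
  have hpm : h ^ (-α) = h ^ β / h := by rw [hα, Real.rpow_sub_one hh.ne']
  have hp2 : h ^ (2 - α) = h * h ^ β := by rw [← hp1]; congr 1; rw [hβ]; ring
  have hp3 : h ^ (3 - α) = h ^ 2 * h ^ β := by
    rw [show 3 - α = 2 + β by rw [hβ]; ring, Real.rpow_add hh]; norm_num
  have hsplit : ∫ s in (0:ℝ)..x, u1 s * s ^ (-α) = ∑ k ∈ Finset.range (N + 1),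
      ∫ s in ((k : ℝ) * h)..(((k + 1 : ℕ) : ℝ) * h), u1 s * s ^ (-α) := by
    rw [intervalIntegral.sum_integral_adjacent_intervals (a := fun k : ℕ => (k : ℝ) * h)]
    · rw [← hx]; simp
    · intro k hk
      refine IntervalIntegrable.continuousOn_mul
        (intervalIntegral.intervalIntegrable_rpow' (by linarith)) ?_
      rw [uIcc_of_le (hab k).le]
      exact hu1c.mono (Icc_subset_Icc (ha k) (hbx k hk))
  have hcell : ∀ k ∈ Finset.range (N + 1),
      |(∫ s in ((k : ℝ) * h)..(((k + 1 : ℕ) : ℝ) * h), u1 s * s ^ (-α))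
        - h ^ (-α) / β * ((u (((k + 1 : ℕ) : ℝ) * h) - u ((k : ℝ) * h)) *
            (((k + 1 : ℕ) : ℝ) ^ β - (k : ℝ) ^ β))
        - c * h ^ (2 - α) * ((((k + 1 : ℕ) : ℝ) ^ (1 + β) - (k : ℝ) ^ (1 + β)) / (1 + β)
      - ((k : ℝ) + 1 / 2) * ((((k + 1 : ℕ) : ℝ) ^ β - (k : ℝ) ^ β) / β))|
      ≤ M * h ^ (3 - α) * (((k : ℝ) + 1) * ((((k + 1 : ℕ) : ℝ) ^ β - (k : ℝ) ^ β) / β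
      - ((k + 1 : ℕ) : ℝ) ^ (β - 1))) := by
    intro k hk
    have := cell α x _ _ c M h0 h1 (ha k) (hab k) (hbx k (Finset.mem_range.1 hk)) hM u u1 u2 hu hu1 hu2
    rw [hdiff, hI0, ← hβ, hI1] at this
    have e1 : (((k + 1 : ℕ) : ℝ) * h) ^ (-α) = ((k + 1 : ℕ) : ℝ) ^ (β - 1) * (h ^ β / h) := by
      rw [Real.mul_rpow (by positivity) hh.le, hpm, hα]
    rw [e1] at this
    convert this using 1
    · congr 1
      rw [hpm, hp2, hp1]
      push_cast
      field_simp
      ring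
    · rw [hp3]
      push_cast
      field_simp
  rw [hsplit, ← sum_T β hβ0 N, Finset.mul_sum, Finset.mul_sum, ← Finset.sum_sub_distrib,
    ← Finset.sum_sub_distrib]
  refine (Finset.abs_sum_le_sum_abs _ _).trans ((Finset.sum_le_sum hcell).trans ?_)
  rw [← Finset.mul_sum]
  exact mul_le_mul_of_nonneg_left (sum_err β hβ0 (by linarith) (N + 1)) (by positivity)

lemma weights_partial (α : ℝ) (hα1 : α < 1) (n : ℕ) (v : ℕ → ℝ) (m : ℕ) (hm : m + 3 ≤ n) :
    ∑ k ∈ Finset.range (m + 3), ML1weight α n k * v k =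
      -∑ k ∈ Finset.range (m + 2),
        (v (k + 1) - v k) * (((k + 1 : ℕ) : ℝ) ^ (1 - α) - (k : ℝ) ^ (1 - α))
      + v (m + 2) * (((m + 3 : ℕ) : ℝ) ^ (1 - α) - ((m + 2 : ℕ) : ℝ) ^ (1 - α))
      - zetaR (α - 1) * (v 0 - 2 * v 1 + v 2) := by
  induction m with
  | zero =>
    have h2 : (2 : ℝ) ^ (2 - α) = 2 * (2 : ℝ) ^ (1 - α) := by
      rw [show 2 - α = 1 + (1 - α) by ring, Real.rpow_add (by norm_num), Real.rpow_one]
    have hz : (0 : ℝ) ^ (1 - α) = 0 := Real.zero_rpow (by linarith)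
    simp [Finset.sum_range_succ, ML1weight, h2, hz]
    ring_nf
  | succ m ih =>
    rw [show m + 1 + 3 = (m + 3) + 1 by ring, Finset.sum_range_succ, ih (by omega),
      show m + 1 + 2 = (m + 2) + 1 by ring, Finset.sum_range_succ _ (m + 2)]
    have hw : ML1weight α n (m + 3) = ((m + 2 : ℕ) : ℝ) ^ (1 - α)
        - 2 * ((m + 3 : ℕ) : ℝ) ^ (1 - α) + ((m + 4 : ℕ) : ℝ) ^ (1 - α) := by
      unfold ML1weight
      rw [if_neg (by omega), if_neg (by omega), if_neg (by omega), if_neg (by omega)]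
      congr 2
      · congr 1
        push_cast; ring
      · push_cast; ring
    rw [hw]
    rw [show m + 2 + 1 = m + 3 by ring, show m + 3 + 1 = m + 4 by ring]
    ring

lemma weights_sum (α : ℝ) (hα1 : α < 1) (N : ℕ) (hN : 3 ≤ N) (v : ℕ → ℝ) :
    ∑ k ∈ Finset.range (N + 1 + 1), ML1weight α (N + 1) k * v k =
      -∑ k ∈ Finset.range (N + 1),
        (v (k + 1) - v k) * (((k + 1 : ℕ) : ℝ) ^ (1 - α) - (k : ℝ) ^ (1 - α))
      - zetaR (α - 1) * (v 0 - 2 * v 1 + v 2) := by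
  obtain ⟨m, rfl⟩ : ∃ m, N = m + 2 := ⟨N - 2, by omega⟩
  have hp := weights_partial α hα1 (m + 2 + 1) v m (by omega)
  rw [show m + 2 + 1 = m + 3 by ring] at hp ⊢
  rw [Finset.sum_range_succ _ (m + 3)]
  rw [hp, Finset.sum_range_succ _ (m + 2)]
  have hw : ML1weight α (m + 3) (m + 3) = ((m + 2 : ℕ) : ℝ) ^ (1 - α)
        - ((m + 3 : ℕ) : ℝ) ^ (1 - α) := by
      unfold ML1weight
      rw [if_neg (by omega), if_neg (by omega), if_neg (by omega), if_pos rfl]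
      congr 2
      push_cast; ring
  rw [hw, show m + 2 + 1 = m + 3 by ring]
  ring

lemma second_diff (x h c M : ℝ) (hh : 0 < h) (hx : 2 * h ≤ x) (hM : 0 ≤ M) (u u1 u2 : ℝ → ℝ)
    (hu : ∀ s ∈ Icc 0 x, HasDerivWithinAt u (u1 s) (Icc 0 x) s)
    (hu1 : ∀ s ∈ Icc 0 x, HasDerivWithinAt u1 (u2 s) (Icc 0 x) s)
    (hu2 : ∀ s ∈ Icc 0 x, |u2 s - c| ≤ M * s) :
    |u 0 - 2 * u h + u (2 * h) - c * h ^ 2| ≤ 24 * M * h ^ 3 := by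
  have hsub : Icc 0 (2 * h) ⊆ Icc 0 x := Icc_subset_Icc le_rfl hx
  have b1 : ∀ s ∈ Icc 0 (2 * h), |u1 s - c * s - u1 0| ≤ M * (2 * h) * (2 * h) := by
    intro s hs
    have := norm_image_sub_le_of_norm_deriv_le_segment' (C := M * (2 * h))
      (f := fun s => u1 s - c * s) (f' := fun s => u2 s - c) (a := 0) (b := 2 * h)
      (fun t ht => by
        have e2 : HasDerivAt (fun s : ℝ => c * s) c t := by
          simpa using (hasDerivAt_id t).const_mul c
        exact ((hu1 t (hsub ht)).mono hsub).sub e2.hasDerivWithinAt)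
      (fun t ht => by
        rw [Real.norm_eq_abs]
        exact (hu2 t (hsub (Ico_subset_Icc_self ht))).trans
          (mul_le_mul_of_nonneg_left ht.2.le hM)) s hs
    rw [Real.norm_eq_abs] at this
    simp only [mul_zero, sub_zero] at this
    refine this.trans ?_
    have := hs.2
    gcongr
  have b2 : ∀ s ∈ Icc 0 (2 * h), |u s - c * (s ^ 2 / 2) - u1 0 * s - u 0| ≤ 8 * M * h ^ 3 := by
    intro s hs
    have := norm_image_sub_le_of_norm_deriv_le_segment' (C := M * (2 * h) * (2 * h))
      (f := fun s => u s - c * (s ^ 2 / 2) - u1 0 * s)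
      (f' := fun s => u1 s - c * s - u1 0) (a := 0) (b := 2 * h)
      (fun t ht => by
        have e2 : HasDerivAt (fun s : ℝ => c * (s ^ 2 / 2)) (c * t) t := by
          have := (((hasDerivAt_id t).pow 2).div_const 2).const_mul c
          convert! this using 1
          simp
        have e3 : HasDerivAt (fun s : ℝ => u1 0 * s) (u1 0) t := by
          simpa using (hasDerivAt_id t).const_mul (u1 0)
        exact (((hu t (hsub ht)).mono hsub).sub e2.hasDerivWithinAt).sub e3.hasDerivWithinAt)
      (fun t ht => by
        rw [Real.norm_eq_abs]
        exact b1 t (Ico_subset_Icc_self ht)) s hs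
    rw [Real.norm_eq_abs] at this
    simp only [mul_zero, sub_zero, ne_eq, OfNat.ofNat_ne_zero, not_false_eq_true, zero_pow,
      zero_div] at this
    refine this.trans ?_
    calc M * (2 * h) * (2 * h) * s ≤ M * (2 * h) * (2 * h) * (2 * h) := by
          have := hs.2
          gcongr
      _ = _ := by ring
  have c1 := abs_le.1 (b2 h ⟨hh.le, by linarith⟩)
  have c2 := abs_le.1 (b2 (2 * h) ⟨by linarith, le_rfl⟩)
  rw [abs_le]
  constructor <;> nlinarith [c1.1, c1.2, c2.1, c2.2]

/-- The estimate in terms of `u s = y (x - s)`. -/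
lemma main_abs (α x c M : ℝ) (h0 : 0 < α) (h1 : α < 1) (hx : 0 < x)
    (hM : 0 ≤ M) (u u1 u2 : ℝ → ℝ)
    (hu : ∀ s ∈ Icc 0 x, HasDerivWithinAt u (u1 s) (Icc 0 x) s)
    (hu1 : ∀ s ∈ Icc 0 x, HasDerivWithinAt u1 (u2 s) (Icc 0 x) s)
    (hu2 : ∀ s ∈ Icc 0 x, |u2 s - c| ≤ M * s) :
    ∃ C > 0, ∀ N : ℕ, 3 ≤ N → ∀ h : ℝ, x = ((N + 1 : ℕ) : ℝ) * h →
      |(1 / (Real.Gamma (2 - α) * h ^ α)) *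
          (∑ k ∈ Finset.range (N + 1 + 1), ML1weight α (N + 1) k * u ((k : ℝ) * h)) +
        (1 / Real.Gamma (1 - α)) * ∫ s in (0:ℝ)..x, u1 s * s ^ (-α)| ≤ C * h ^ 2 := by
  obtain ⟨K, hK0, hK⟩ := Tn_rate (1 - α) (by linarith) (by linarith)
  have hβ0 : 0 < 1 - α := by linarith
  have hΓ : 0 < Real.Gamma (1 - α) := Real.Gamma_pos_of_pos hβ0
  have hΓ2 : Real.Gamma (2 - α) = (1 - α) * Real.Gamma (1 - α) := by
    rw [← Real.Gamma_add_one hβ0.ne']; congr 1; ring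
  set Z := zetaR (α - 1) with hZ
  set D : ℝ := M * (x ^ (1 - α) / (1 - α)) + |c| * (K * x ^ (-α)) / (1 - α)
      + |Z| * (24 * M * x ^ (1 - α)) / (1 - α) with hD
  have hD0 : 0 ≤ D := by positivity
  refine ⟨D / Real.Gamma (1 - α) + 1, by positivity, fun N hN h hxh => ?_⟩
  have hn0 : (0 : ℝ) < ((N + 1 : ℕ) : ℝ) := by positivity
  have hh : 0 < h := by
    by_contra hcon
    push Not at hcon
    nlinarith
  have hhx : h ≤ x := by
    rw [hxh]
    have : (1 : ℝ) ≤ ((N + 1 : ℕ) : ℝ) := by exact_mod_cast Nat.le_add_left 1 N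
    nlinarith
  have h2hx : 2 * h ≤ x := by
    rw [hxh]
    have : (2 : ℝ) ≤ ((N + 1 : ℕ) : ℝ) := by exact_mod_cast (by omega : 2 ≤ N + 1)
    nlinarith
  have hL := L1_expansion α x h c M h0 h1 hh N hxh hM u u1 u2 hu hu1 hu2
  have hQ := second_diff x h c M hh h2hx hM u u1 u2 hu hu1 hu2
  have hT := hK N
  rw [show -(1 - α) = α - 1 by ring, ← hZ] at hT
  have hws := weights_sum α h1 N hN (fun k : ℕ => u ((k : ℝ) * h))
  rw [← hZ] at hws
  simp only [Nat.cast_zero, zero_mul, Nat.cast_one, one_mul, Nat.cast_ofNat] at hws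
  rw [hws, hΓ2]
  set J := ∫ s in (0:ℝ)..x, u1 s * s ^ (-α)
  set S := ∑ k ∈ Finset.range (N + 1),
          (u (((k + 1 : ℕ) : ℝ) * h) - u ((k : ℝ) * h)) *
            (((k + 1 : ℕ) : ℝ) ^ (1 - α) - (k : ℝ) ^ (1 - α))
  set T := Tn (1 - α) N
  set W := u 0 - 2 * u h + u (2 * h)
  have hhα : h ^ (-α) = (h ^ α)⁻¹ := Real.rpow_neg hh.le α
  have hha : 0 < h ^ α := by positivity
  have p2 : h ^ (2 - α) = h ^ 2 * h ^ (-α) := by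
    rw [sub_eq_add_neg, Real.rpow_add hh]; norm_num
  have p1 : h ^ (1 - α) = h * h ^ (-α) := by
    rw [sub_eq_add_neg, Real.rpow_add hh]; norm_num
  have p3 : h ^ (3 - α) = h ^ 2 * h ^ (1 - α) := by
    rw [show 3 - α = 2 + (1 - α) by ring, Real.rpow_add hh]; norm_num
  have hxβ : x ^ (1 - α) = ((N + 1 : ℕ) : ℝ) ^ (1 - α) * h ^ (1 - α) := by
    rw [hxh, Real.mul_rpow hn0.le hh.le]
  have hxα : x ^ (-α) = ((N + 1 : ℕ) : ℝ) ^ (-α) * h ^ (-α) := by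
    rw [hxh, Real.mul_rpow hn0.le hh.le]
  have hexp : 1 / ((1 - α) * Real.Gamma (1 - α) * h ^ α) * (-S - Z * W)
      + 1 / Real.Gamma (1 - α) * J = (1 / Real.Gamma (1 - α)) *
      ((J - h ^ (-α) / (1 - α) * S - c * h ^ (2 - α) * (T / (1 - α)))
        + c * h ^ (2 - α) * (T - Z) / (1 - α) - h ^ (-α) * Z * (W - c * h ^ 2) / (1 - α)) := by
    rw [p2, hhα]
    field_simp
    ring
  rw [hexp, abs_mul, abs_of_pos (by positivity : 0 < 1 / Real.Gamma (1 - α))]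
  have q1 : M * h ^ (3 - α) * (((N + 1 : ℕ) : ℝ) ^ (1 - α) / (1 - α))
      = M * (x ^ (1 - α) / (1 - α)) * h ^ 2 := by rw [p3, hxβ]; ring
  have q2 : |c * h ^ (2 - α) * (T - Z) / (1 - α)| ≤ |c| * (K * x ^ (-α)) / (1 - α) * h ^ 2 := by
    rw [abs_div, abs_mul, abs_mul, abs_of_pos hβ0, abs_of_pos (by positivity : 0 < h ^ (2 - α))]
    rw [show -(1 - (1 - α)) = -α by ring] at hT
    calc |c| * h ^ (2 - α) * |T - Z| / (1 - α)
        ≤ |c| * h ^ (2 - α) * (K * ((N + 1 : ℕ) : ℝ) ^ (-α)) / (1 - α) := by gcongr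
      _ = _ := by rw [p2, hxα]; ring
  have q3 : |h ^ (-α) * Z * (W - c * h ^ 2) / (1 - α)|
      ≤ |Z| * (24 * M * x ^ (1 - α)) / (1 - α) * h ^ 2 := by
    rw [abs_div, abs_mul, abs_mul, abs_of_pos hβ0, abs_of_pos (by positivity : 0 < h ^ (-α))]
    have hle : h ^ (1 - α) ≤ x ^ (1 - α) := Real.rpow_le_rpow hh.le hhx hβ0.le
    calc h ^ (-α) * |Z| * |W - c * h ^ 2| / (1 - α)
        ≤ h ^ (-α) * |Z| * (24 * M * h ^ 3) / (1 - α) := by gcongr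
      _ = |Z| * (24 * M * h ^ (1 - α)) / (1 - α) * h ^ 2 := by rw [p1]; ring
      _ ≤ _ := by gcongr
  rw [q1] at hL
  have htot : |(J - h ^ (-α) / (1 - α) * S - c * h ^ (2 - α) * (T / (1 - α)))
        + c * h ^ (2 - α) * (T - Z) / (1 - α) - h ^ (-α) * Z * (W - c * h ^ 2) / (1 - α)|
        ≤ D * h ^ 2 := by
    refine (abs_sub _ _).trans ?_
    refine (add_le_add (abs_add_le _ _) le_rfl).trans ?_
    rw [hD]
    linarith
  calc _ ≤ 1 / Real.Gamma (1 - α) * (D * h ^ 2) := by gcongr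
    _ = D / Real.Gamma (1 - α) * h ^ 2 := by ring
    _ ≤ _ := by nlinarith [sq_nonneg h]

lemma hasDerivWithin_reflect (x : ℝ) (f : ℝ → ℝ) (f' s : ℝ)
    (hf : HasDerivWithinAt f f' (Icc 0 x) (x - s)) :
    HasDerivWithinAt (fun s => f (x - s)) (-f') (Icc 0 x) s := by
  have hi : HasDerivWithinAt (fun s : ℝ => x - s) (-1) (Icc 0 x) s := by
    simpa using (hasDerivWithinAt_id s (Icc 0 x)).const_sub x
  have := HasDerivWithinAt.comp s hf hi (fun t ht => ⟨by linarith [ht.2], by linarith [ht.1]⟩)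
  simpa [Function.comp_def] using! this

end ML1proof

/-- Equation (ML1) of the paper: the modified L1 approximation for the Caputo
derivative has second-order accuracy `O(h²)`. -/
theorem modified_L1_second_order (α x : ℝ) (hα0 : 0 < α) (hα1 : α < 1)
    (hx : 0 < x) (y : ℝ → ℝ) (hy : ContDiffOn ℝ 6 y (Set.Icc 0 x)) :
    ∃ C > 0, ∀ n : ℕ, 4 ≤ n → ∀ h : ℝ, h = x / n →
      |(1 / (Real.Gamma (2 - α) * h ^ α)) *
          (∑ k ∈ Finset.range (n + 1), ML1weight α n k * y ((↑(n - k) : ℝ) * h)) -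
        caputo α y x| ≤ C * h ^ 2 := by
  have hu : UniqueDiffOn ℝ (Set.Icc 0 x) := uniqueDiffOn_Icc hx
  set I := Set.Icc (0 : ℝ) x with hI
  set y1 := derivWithin y I with hy1
  set y2 := derivWithin y1 I with hy2
  set y3 := derivWithin y2 I with hy3
  have c1 : ContDiffOn ℝ 5 y1 I := hy.derivWithin hu (by norm_num)
  have c2 : ContDiffOn ℝ 4 y2 I := c1.derivWithin hu (by norm_num)
  have c3 : ContDiffOn ℝ 3 y3 I := c2.derivWithin hu (by norm_num)
  have d0 : ∀ t ∈ I, HasDerivWithinAt y (y1 t) I t := fun t ht =>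
    ((hy.differentiableOn (by norm_num)) t ht).hasDerivWithinAt
  have d1 : ∀ t ∈ I, HasDerivWithinAt y1 (y2 t) I t := fun t ht =>
    ((c1.differentiableOn (by norm_num)) t ht).hasDerivWithinAt
  have d2 : ∀ t ∈ I, HasDerivWithinAt y2 (y3 t) I t := fun t ht =>
    ((c2.differentiableOn (by norm_num)) t ht).hasDerivWithinAt
  obtain ⟨M, hM⟩ := isCompact_Icc.exists_bound_of_continuousOn c3.continuousOn
  have h0I : (0 : ℝ) ∈ I := ⟨le_rfl, hx.le⟩
  have hxI : x ∈ I := ⟨hx.le, le_rfl⟩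
  have hM0 : 0 ≤ M := (norm_nonneg _).trans (hM 0 h0I)
  have hrefl : ∀ s ∈ I, x - s ∈ I := fun s hs => ⟨by linarith [hs.2], by linarith [hs.1]⟩
  obtain ⟨C, hC, hmain⟩ := ML1proof.main_abs α x (y2 x) M hα0 hα1 hx hM0
    (fun s => y (x - s)) (fun s => -y1 (x - s)) (fun s => y2 (x - s))
    (fun s hs => ML1proof.hasDerivWithin_reflect x y _ s (d0 _ (hrefl s hs)))
    (fun s hs => by
      have := (ML1proof.hasDerivWithin_reflect x y1 _ s (d1 _ (hrefl s hs))).neg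
      rw [neg_neg] at this
      exact this)
    (fun s hs => by
      have := (convex_Icc (0 : ℝ) x).norm_image_sub_le_of_norm_hasDerivWithin_le d2 hM hxI
        (hrefl s hs)
      rw [Real.norm_eq_abs, Real.norm_eq_abs] at this
      refine this.trans (le_of_eq ?_)
      congr 1
      rw [show x - s - x = -s by ring, abs_neg, abs_of_nonneg hs.1])
  refine ⟨C, hC, fun n hn h hh => ?_⟩
  obtain ⟨N, rfl⟩ : ∃ N, n = N + 1 := ⟨n - 1, by omega⟩
  have hxh : x = ((N + 1 : ℕ) : ℝ) * h := by
    rw [hh]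
    have : ((N + 1 : ℕ) : ℝ) ≠ 0 := by positivity
    field_simp
  have := hmain N (by omega) h hxh
  have hcap : caputo α y x = -((1 / Real.Gamma (1 - α)) *
      ∫ s in (0:ℝ)..x, -y1 (x - s) * s ^ (-α)) := by
    unfold caputo
    have e1 : ∫ t in (0:ℝ)..x, deriv y t * (x - t) ^ (-α) =
        ∫ t in (0:ℝ)..x, y1 t * (x - t) ^ (-α) := by
      refine intervalIntegral.integral_congr_ae ?_
      have hne : ∀ᵐ t : ℝ ∂MeasureTheory.volume, t ≠ x := by
        simp [MeasureTheory.ae_iff]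
      filter_upwards [hne] with t ht htI
      rw [Set.uIoc_of_le hx.le] at htI
      have hnh : I ∈ nhds t := Icc_mem_nhds htI.1 (lt_of_le_of_ne htI.2 ht)
      rw [hy1, derivWithin_of_mem_nhds hnh]
    have e2 : ∫ t in (0:ℝ)..x, y1 t * (x - t) ^ (-α) =
        ∫ s in (0:ℝ)..x, y1 (x - s) * s ^ (-α) := by
      have := intervalIntegral.integral_comp_sub_left (a := 0) (b := x)
        (fun t => y1 t * (x - t) ^ (-α)) x
      simp only [sub_sub_cancel, sub_zero, sub_self] at this
      exact this.symm
    rw [e1, e2]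
    simp only [neg_mul, intervalIntegral.integral_neg]
    ring
  rw [hcap, sub_neg_eq_add]
  have hsum : ∑ k ∈ Finset.range (N + 1 + 1), ML1weight α (N + 1) k * y ((↑(N + 1 - k) : ℝ) * h)
      = ∑ k ∈ Finset.range (N + 1 + 1), ML1weight α (N + 1) k * y (x - (k : ℝ) * h) := by
    refine Finset.sum_congr rfl fun k hk => ?_
    have hk' : k ≤ N + 1 := by have := Finset.mem_range.1 hk; omega
    rw [Nat.cast_sub hk', sub_mul, ← hxh]
  rw [hsum]
  exact this
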